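/- Let H be a weak uniform Glivenko-Cantelli class with M = sup_{f∈H} [sup f − inf f]. Then for every ε > 0 there exists n₀ ∈ ℕ such that for all n > n₀ and all P ∈ 𝒫, Pⁿ{ ‖P_n − P‖_H* > ε } ≤ 2 exp( −3nε² / (8M(15M + ε)) ). -/

import Mathlib

open MeasureTheory Filter ENNReal

/-- The empirical discrepancy `‖P_n − P‖_H` at the sample `s ∈ Sⁿ`:
the supremum over `f ∈ H` of the distance between the empirical mean of `f`
at `s` and the integral of `f` with respect to `P`. -/
noncomputable def empDev {S : Type*} [MeasurableSpace S] (H : Set (S → ℝ))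
    (P : MeasureTheory.Measure S) (n : ℕ) (s : Fin n → S) : ℝ :=
  ⨆ f ∈ H, |(∑ i, f (s i)) / n - ∫ x, f x ∂P|

/-- The empirical discrepancy `‖P_k − P‖_H` computed from the first `k` coordinates of an
infinite sample `ω ∈ S^∞`. -/
noncomputable def empDevSeq {S : Type*} [MeasurableSpace S] (H : Set (S → ℝ))
    (P : MeasureTheory.Measure S) (k : ℕ) (ω : ℕ → S) : ℝ :=
  ⨆ f ∈ H, |(∑ i ∈ Finset.range k, f (ω i)) / k - ∫ x, f x ∂P|

/-- `M = sup_{f ∈ H} [sup f − inf f]`, valued in the extended reals. -/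
noncomputable def gcM {S : Type*} (H : Set (S → ℝ)) : EReal :=
  ⨆ f ∈ H, ((⨆ x, (f x : EReal)) - ⨅ x, (f x : EReal))

/-- `M = sup_{f ∈ H} [sup f − inf f]`, as a real number (junk value conventions of `ℝ`-valued
`⨆`/`⨅` apply when the quantities involved are unbounded). -/
noncomputable def gcMReal {S : Type*} (H : Set (S → ℝ)) : ℝ :=
  ⨆ f ∈ H, ((⨆ x, f x) - ⨅ x, f x)

/-- The upper expectation `E[g*]` of `g` with respect to `μ`: the infimum of the integrals of
integrable measurable (everywhere) majorants of `g`.  When `g` admits an integrable measurable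
cover function `g*`, this is exactly `E[g*]`. -/
noncomputable def upperExp {α : Type*} [MeasurableSpace α] (μ : MeasureTheory.Measure α)
    (g : α → ℝ) : ℝ :=
  sInf {r | ∃ h : α → ℝ, Measurable h ∧ (∀ x, g x ≤ h x) ∧
    MeasureTheory.Integrable h μ ∧ r = ∫ x, h x ∂μ}

/-- `μ` is the countable product `P^∞` of copies of the probability measure `P`:
it is a probability measure on `ℕ → S` whose finite-dimensional projections are the
finite product measures `Pⁿ`. -/
def IsCountableProduct {S : Type*} [MeasurableSpace S] (P : MeasureTheory.Measure S)
    (μ : MeasureTheory.Measure (ℕ → S)) : Prop :=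
  MeasureTheory.IsProbabilityMeasure μ ∧
    ∀ n : ℕ, μ.map (fun ω (i : Fin n) => ω i) = MeasureTheory.Measure.pi fun _ : Fin n => P

/-- `H` is a weak uniform Glivenko–Cantelli class: for every `ε > 0`,
`sup_{P ∈ 𝒫} Pⁿ{‖P_n − P‖_H > ε} → 0` as `n → ∞` (sets of non-measurable events are
measured by the outer measure, i.e. by the measure of a measurable cover). -/
def IsWeakUniformGC {S : Type*} [MeasurableSpace S] (H : Set (S → ℝ)) : Prop :=
  ∀ ε : ℝ, 0 < ε →
    Tendsto (fun n : ℕ => ⨆ P : {P : MeasureTheory.Measure S // MeasureTheory.IsProbabilityMeasure P},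
        (MeasureTheory.Measure.pi fun _ : Fin n => P.1) {s | ε < empDev H P.1 n s})
      atTop (nhds 0)

/-- `H` is a strong uniform Glivenko–Cantelli class: for every assignment `P ↦ P^∞` of countable
product measures and every `ε > 0`,
`sup_{P ∈ 𝒫} P^∞{sup_{k ≥ n} ‖P_k − P‖_H > ε} → 0` as `n → ∞`. -/
def IsStrongUniformGC {S : Type*} [MeasurableSpace S] (H : Set (S → ℝ)) : Prop :=
  ∀ Pinf : {P : MeasureTheory.Measure S // MeasureTheory.IsProbabilityMeasure P} →
      MeasureTheory.Measure (ℕ → S),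
    (∀ P, IsCountableProduct P.1 (Pinf P)) →
    ∀ ε : ℝ, 0 < ε →
      Tendsto (fun n : ℕ => ⨆ P : {P : MeasureTheory.Measure S // MeasureTheory.IsProbabilityMeasure P},
          Pinf P {ω | ∃ k, n ≤ k ∧ ε < empDevSeq H P.1 k ω})
        atTop (nhds 0)

/-- `h` is a measurable cover function (minimal measurable majorant) of `g` w.r.t. `μ`. -/
def IsMeasCover {α : Type*} [MeasurableSpace α] (μ : MeasureTheory.Measure α)
    (g h : α → ℝ) : Prop :=
  Measurable h ∧ (∀ᵐ x ∂μ, g x ≤ h x) ∧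
    ∀ h' : α → ℝ, Measurable h' → (∀ᵐ x ∂μ, g x ≤ h' x) → ∀ᵐ x ∂μ, h x ≤ h' x

/-! ### Functions integrable for every probability measure are bounded -/

lemma lintegral_dirac_of_aemeasurable {α : Type*} [MeasurableSpace α] {a : α} {f : α → ℝ≥0∞}
    (hf : AEMeasurable f (Measure.dirac a)) : ∫⁻ x, f x ∂Measure.dirac a = f a := by
  rw [lintegral_congr_ae hf.ae_eq_mk, lintegral_dirac' a hf.measurable_mk]
  by_contra hne
  have hnull : Measure.dirac a {x | ¬ f x = hf.mk f x} = 0 := ae_iff.1 hf.ae_eq_mk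
  rw [Measure.dirac_apply_of_mem (show a ∈ {x | ¬ f x = hf.mk f x} from fun h => hne h.symm)]
    at hnull
  exact one_ne_zero hnull

lemma exists_abs_le_of_forall_integrable {S : Type*} [MeasurableSpace S] {f : S → ℝ}
    (hf : ∀ P : Measure S, IsProbabilityMeasure P → Integrable f P) :
    ∃ B, ∀ x, |f x| ≤ B := by
  by_contra! hunb
  choose u hu using fun k : ℕ => hunb (2 ^ (k + 1))
  let P : Measure S := Measure.sum fun k : ℕ => ((2 : ℝ≥0∞)⁻¹ ^ (k + 1)) • Measure.dirac (u k)
  have hP : IsProbabilityMeasure P := ⟨by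
    simp only [P, Measure.sum_apply _ MeasurableSet.univ, Measure.smul_apply, measure_univ,
      smul_eq_mul, mul_one]
    rw [ENNReal.tsum_geometric_add_one, ENNReal.one_sub_inv_two, inv_inv]
    exact ENNReal.inv_mul_cancel (by simp) (by simp)⟩
  have hfin : ∫⁻ x, ‖f x‖ₑ ∂P < ∞ := (hf P hP).2
  refine hfin.ne ?_
  rw [lintegral_sum_measure, eq_top_iff, ← ENNReal.tsum_const_eq_top_of_ne_zero (α := ℕ)
    (one_ne_zero : (1 : ℝ≥0∞) ≠ 0)]
  refine ENNReal.tsum_le_tsum fun k => ?_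
  rw [lintegral_smul_measure, lintegral_dirac_of_aemeasurable
    (hf _ Measure.dirac.isProbabilityMeasure).1.enorm, smul_eq_mul]
  have hle : (2 : ℝ≥0∞) ^ (k + 1) ≤ ‖f (u k)‖ₑ := by
    rw [← ofReal_norm, Real.norm_eq_abs]
    have h2 : (2 : ℝ≥0∞) ^ (k + 1) = ENNReal.ofReal (2 ^ (k + 1)) := by
      rw [ENNReal.ofReal_pow (by norm_num)]; simp
    rw [h2]
    exact ENNReal.ofReal_le_ofReal (hu k).le
  calc (1 : ℝ≥0∞) = 2⁻¹ ^ (k + 1) * 2 ^ (k + 1) := by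
        rw [← mul_pow, ENNReal.inv_mul_cancel (by simp) (by simp), one_pow]
    _ ≤ _ := by gcongr

/-! ### Measurable covers of bounded functions -/

lemma exists_measurable_cover_of_mem_Icc {α : Type*} [MeasurableSpace α] (μ : Measure α)
    [IsFiniteMeasure μ] {g : α → ℝ} {C : ℝ} (hg : ∀ x, g x ∈ Set.Icc 0 C) :
    ∃ U : α → ℝ, Measurable U ∧ (∀ x, g x ≤ U x) ∧ (∀ x, U x ≤ C) ∧
      ∀ h : α → ℝ, Measurable h → (∀ x, g x ≤ h x) → ∀ᵐ x ∂μ, U x ≤ h x := by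
  obtain ⟨k, hkm, hkle, hkint⟩ :=
    exists_measurable_le_lintegral_eq (μ := μ) fun x => ENNReal.ofReal (C - g x)
  have hktop : ∀ x, k x ≠ ∞ := fun x => ((hkle x).trans_lt ENNReal.ofReal_lt_top).ne
  have hkC : ∫⁻ x, k x ∂μ ≠ ∞ := by
    refine ne_top_of_le_ne_top (b := ∫⁻ _, ENNReal.ofReal C ∂μ) ?_
      (lintegral_mono fun x => (hkle x).trans (ENNReal.ofReal_le_ofReal ?_))
    · rw [lintegral_const]
      exact ENNReal.mul_ne_top ENNReal.ofReal_ne_top (measure_ne_top _ _)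
    · linarith [(hg x).1]
  refine ⟨fun x => C - (k x).toReal, measurable_const.sub hkm.ennreal_toReal, fun x => ?_,
    fun x => by linarith [(k x).toReal_nonneg], fun h hh hgh => ?_⟩
  · have := ENNReal.toReal_le_of_le_ofReal (by linarith [(hg x).2]) (hkle x)
    linarith
  · have hk'm : Measurable fun x => ENNReal.ofReal (C - h x) :=
      (measurable_const.sub hh).ennreal_ofReal
    have heq := ae_eq_of_ae_le_of_lintegral_le (μ := μ) (f := k)
      (g := fun x => max (k x) (ENNReal.ofReal (C - h x)))
      (ae_of_all _ fun x => le_max_left _ _) hkC (hkm.max hk'm).aemeasurable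
      (hkint ▸ lintegral_mono fun x => max_le (hkle x)
        (ENNReal.ofReal_le_ofReal (by linarith [hgh x])))
    filter_upwards [heq] with x hx
    have hle : ENNReal.ofReal (C - h x) ≤ k x := hx ▸ le_max_right _ _
    have := (ENNReal.ofReal_le_iff_le_toReal (hktop x)).1 hle
    linarith

/-! ### A bounded differences inequality with almost-everywhere hypotheses -/

lemma measurePreserving_finCons {S : Type*} [MeasurableSpace S] (P : Measure S) [SigmaFinite P]
    (n : ℕ) :
    MeasurePreserving (fun p : (Fin n → S) × S => (Fin.cons p.2 p.1 : Fin (n + 1) → S))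
      ((Measure.pi fun _ : Fin n => P).prod P) (Measure.pi fun _ : Fin (n + 1) => P) := by
  have h := ((measurePreserving_piFinSuccAbove (fun _ : Fin (n + 1) => P) 0).symm).comp
    (Measure.measurePreserving_swap (μ := Measure.pi fun _ : Fin n => P) (ν := P))
  convert h using 1
  ext p : 1
  simp [MeasurableEquiv.piFinSuccAbove_symm_apply, Fin.consEquiv]

lemma integrable_of_abs_le {α : Type*} [MeasurableSpace α] {μ : Measure α} [IsFiniteMeasure μ]
    {F : α → ℝ} {B : ℝ} (hF : Measurable F) (hB : ∀ x, |F x| ≤ B) : Integrable F μ :=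
  Integrable.of_bound hF.aestronglyMeasurable B (ae_of_all _ hB)

lemma integrable_exp_mul_of_abs_le {α : Type*} [MeasurableSpace α] {μ : Measure α}
    [IsFiniteMeasure μ] {F : α → ℝ} {B : ℝ} (hF : Measurable F) (hB : ∀ x, |F x| ≤ B) (l : ℝ) :
    Integrable (fun x => Real.exp (l * F x)) μ :=
  ProbabilityTheory.integrable_exp_mul_of_mem_Icc hF.aemeasurable
    (ae_of_all _ fun x => abs_le.1 (hB x))

/-- Hoeffding's lemma for a variable within `c` of its mean. -/
lemma integral_exp_mul_le_of_abs_sub_integral_le {S : Type*} [MeasurableSpace S] {P : Measure S}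
    [IsProbabilityMeasure P] {X : S → ℝ} {c : ℝ} (hX : Measurable X) (hXi : Integrable X P)
    (hc : ∀ᵐ x ∂P, |X x - ∫ y, X y ∂P| ≤ c) (l : ℝ) :
    ∫ x, Real.exp (l * X x) ∂P ≤ Real.exp (l * ∫ x, X x ∂P) * Real.exp (l ^ 2 * c ^ 2 / 2) := by
  have h := (ProbabilityTheory.hasSubgaussianMGF_of_mem_Icc_of_integral_eq_zero
    (X := fun x => X x - ∫ y, X y ∂P) (a := -c) (b := c) (hX.sub_const _).aemeasurable
    (hc.mono fun x hx => abs_le.1 hx)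
    (by rw [integral_sub hXi (integrable_const _)]; simp)).mgf_le l
  have hc2 : ((((‖c - -c‖₊ / 2) ^ 2 : NNReal)) : ℝ) = c ^ 2 := by
    push_cast
    rw [Real.norm_eq_abs, div_pow, sq_abs]
    ring
  rw [hc2] at h
  calc ∫ x, Real.exp (l * X x) ∂P
      = Real.exp (l * ∫ x, X x ∂P) * ∫ x, Real.exp (l * (X x - ∫ y, X y ∂P)) ∂P := by
        rw [← integral_const_mul]
        congr 1
        ext x
        rw [← Real.exp_add]
        ring_nf
    _ ≤ _ := by
        gcongr
        exact h.trans_eq (by ring_nf)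

lemma integral_exp_mul_le_of_ae_update_le {S : Type*} [MeasurableSpace S] (P : Measure S)
    [IsProbabilityMeasure P] (B c l : ℝ) (n : ℕ) (F : (Fin n → S) → ℝ) (hF : Measurable F)
    (hB : ∀ s, |F s| ≤ B)
    (hupd : ∀ i z, ∀ᵐ s ∂Measure.pi fun _ : Fin n => P, F s ≤ F (Function.update s i z) + c) :
    ∫ s, Real.exp (l * F s) ∂(Measure.pi fun _ : Fin n => P) ≤
      Real.exp (l * ∫ s, F s ∂(Measure.pi fun _ : Fin n => P)) *
        Real.exp (n * (l ^ 2 * c ^ 2 / 2)) := by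
  induction n with
  | zero => simp [integral_unique]
  | succ n ih =>
    set μ := Measure.pi fun _ : Fin n => P
    have hcons := measurePreserving_finCons P n
    set E : (Fin n → S) × S → ℝ := fun p => F (Fin.cons p.2 p.1) with hE
    have hEm : Measurable E := hF.comp hcons.measurable
    have hEB : ∀ p, |E p| ≤ B := fun p => hB _
    have hEi : ∀ t, Integrable (fun x => E (t, x)) P := fun t =>
      integrable_of_abs_le (hEm.comp measurable_prodMk_left) fun x => hEB _
    set G : (Fin n → S) → ℝ := fun t => ∫ x, E (t, x) ∂P with hG
    have hGm : Measurable G := hEm.stronglyMeasurable.integral_prod_right'.measurable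
    have hGB : ∀ t, |G t| ≤ B := fun t => by
      simpa using norm_integral_le_of_norm_le_const (μ := P) (f := fun x => E (t, x))
        (ae_of_all _ fun x => hEB (t, x))
    have hpull : ∀ i z, ∀ᵐ t ∂μ, ∀ᵐ x ∂P,
        E (t, x) ≤ F (Function.update (Fin.cons x t : Fin (n + 1) → S) i z) + c := fun i z =>
      Measure.ae_ae_of_ae_prod (hcons.quasiMeasurePreserving.ae (hupd i z))
    have hGupd : ∀ i z, ∀ᵐ t ∂μ, G t ≤ G (Function.update t i z) + c := fun i z => by
      filter_upwards [hpull i.succ z] with t ht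
      calc G t ≤ ∫ x, (E (Function.update t i z, x) + c) ∂P := by
            refine integral_mono_ae (hEi t) ((hEi _).add (integrable_const c)) ?_
            filter_upwards [ht] with x hx
            simpa only [hE, Fin.cons_update] using hx
        _ = _ := by rw [integral_add (hEi _) (integrable_const c)]; simp [hG]
    have hhead : ∀ z, ∀ᵐ t ∂μ, ∀ᵐ x ∂P, E (t, x) ≤ E (t, z) + c := fun z => by
      simpa only [hE, Fin.update_cons_zero] using hpull 0 z
    have hlow : ∀ᵐ t ∂μ, ∀ᵐ z ∂P, G t ≤ E (t, z) + c := by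
      rw [Measure.ae_ae_comm (p := fun t z => G t ≤ E (t, z) + c) (measurableSet_le
        (hGm.comp measurable_fst) (hEm.add_const c))]
      refine ae_of_all _ fun z => ?_
      filter_upwards [hhead z] with t ht
      simpa using integral_mono_ae (hEi t) (integrable_const (E (t, z) + c)) ht
    have hhigh : ∀ᵐ t ∂μ, ∀ᵐ x ∂P, E (t, x) ≤ G t + c := by
      have hm : MeasurableSet {q : S × ((Fin n → S) × S) | E q.2 ≤ E (q.2.1, q.1) + c} :=
        measurableSet_le (hEm.comp measurable_snd)
          ((hEm.comp (by fun_prop : Measurable fun q : S × ((Fin n → S) × S) =>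
            (q.2.1, q.1))).add_const c)
      have hprod : ∀ᵐ z ∂P, ∀ᵐ p ∂μ.prod P, E p ≤ E (p.1, z) + c := ae_of_all _ fun z => by
        have hmz : MeasurableSet {p : (Fin n → S) × S | E p ≤ E (p.1, z) + c} :=
          hm.preimage (measurable_prodMk_left (x := z))
        rw [Measure.ae_prod_iff_ae_ae hmz]
        exact hhead z
      rw [Measure.ae_ae_comm hm] at hprod
      refine Measure.ae_ae_of_ae_prod (p := fun p => E p ≤ G p.1 + c) (hprod.mono fun p hp => ?_)
      calc E p ≤ ∫ z, (E (p.1, z) + c) ∂P := by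
            simpa using integral_mono_ae (integrable_const (E p))
              ((hEi p.1).add (integrable_const c)) hp
        _ = _ := by rw [integral_add (hEi _) (integrable_const c)]; simp [hG]
    have hinner : ∀ᵐ t ∂μ, ∫ x, Real.exp (l * E (t, x)) ∂P ≤
        Real.exp (l * G t) * Real.exp (l ^ 2 * c ^ 2 / 2) := by
      filter_upwards [hlow, hhigh] with t ht1 ht2
      refine integral_exp_mul_le_of_abs_sub_integral_le (X := fun x => E (t, x))
        (hEm.comp measurable_prodMk_left) (hEi t) ?_ l
      filter_upwards [ht1, ht2] with x hx1 hx2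
      exact abs_sub_le_iff.2 ⟨by linarith, by linarith⟩
    have hexp : Integrable (fun p => Real.exp (l * E p)) (μ.prod P) :=
      integrable_exp_mul_of_abs_le hEm hEB l
    have hmean : ∫ s, F s ∂(Measure.pi fun _ : Fin (n + 1) => P) = ∫ t, G t ∂μ := by
      rw [← hcons.map_eq, integral_map hcons.measurable.aemeasurable hF.aestronglyMeasurable]
      exact integral_prod E (integrable_of_abs_le hEm hEB)
    calc ∫ s, Real.exp (l * F s) ∂(Measure.pi fun _ : Fin (n + 1) => P)
        = ∫ t, ∫ x, Real.exp (l * E (t, x)) ∂P ∂μ := by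
          rw [← hcons.map_eq, integral_map hcons.measurable.aemeasurable
            (hF.const_mul l).exp.aestronglyMeasurable]
          exact integral_prod _ hexp
      _ ≤ ∫ t, Real.exp (l * G t) * Real.exp (l ^ 2 * c ^ 2 / 2) ∂μ :=
          integral_mono_ae hexp.integral_prod_left
            ((integrable_exp_mul_of_abs_le hGm hGB l).mul_const _) hinner
      _ = (∫ t, Real.exp (l * G t) ∂μ) * Real.exp (l ^ 2 * c ^ 2 / 2) := integral_mul_const _ _
      _ ≤ Real.exp (l * ∫ t, G t ∂μ) * Real.exp (n * (l ^ 2 * c ^ 2 / 2)) *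
            Real.exp (l ^ 2 * c ^ 2 / 2) := by
          gcongr
          exact ih G hGm hGB hGupd
      _ = _ := by
          rw [hmean, mul_assoc, ← Real.exp_add (n * _)]
          push_cast
          ring_nf

/-- A bounded differences inequality for the outer measure of an upper level set of a
function that need not be measurable. -/
lemma pi_lt_le_of_update_le {S : Type*} [MeasurableSpace S] (P : Measure S)
    [IsProbabilityMeasure P] {M ε : ℝ} (hM : 0 < M) (hε : 0 < ε) {n : ℕ} (hn : 0 < n)
    {g : (Fin n → S) → ℝ} (hg : ∀ s, g s ∈ Set.Icc 0 M)
    (hupd : ∀ i z s, g s ≤ g (Function.update s i z) + M / n)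
    (hsmall : (Measure.pi fun _ : Fin n => P) {s | ε / 4 < g s} ≤ ENNReal.ofReal (ε / (4 * M))) :
    (Measure.pi fun _ : Fin n => P) {s | ε < g s} ≤
      ENNReal.ofReal (Real.exp (-(n * ε ^ 2) / (8 * M ^ 2))) := by
  set μ := Measure.pi fun _ : Fin n => P
  obtain ⟨U, hUm, hgU, hUM, hUmin⟩ := exists_measurable_cover_of_mem_Icc μ hg
  have hUabs : ∀ s, |U s| ≤ M := fun s =>
    abs_le.2 ⟨by linarith [(hg s).1, hgU s], hUM s⟩
  have hUupd : ∀ i z, ∀ᵐ s ∂μ, U s ≤ U (Function.update s i z) + M / n := fun i z =>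
    hUmin _ ((hUm.comp (measurable_update_left)).add_const _)
      fun s => (hupd i z s).trans (by linarith [hgU (Function.update s i z)])
  have hmean : ∫ s, U s ∂μ ≤ ε / 2 := by
    set T := toMeasurable μ {s | ε / 4 < g s}
    have hT : MeasurableSet T := measurableSet_toMeasurable _ _
    have hTμ : μ.real T ≤ ε / (4 * M) := by
      rw [measureReal_def, measure_toMeasurable]
      exact ENNReal.toReal_le_of_le_ofReal (by positivity) hsmall
    have hind : Integrable (T.indicator fun _ => M) μ := (integrable_const M).indicator hT
    have hle := hUmin (fun s => ε / 4 + T.indicator (fun _ => M) s)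
      ((measurable_const.indicator hT).const_add _) fun s => by
        by_cases hs : s ∈ T
        · simp only [Set.indicator_of_mem hs]
          linarith [(hg s).2]
        · have : ¬ ε / 4 < g s := fun h => hs (subset_toMeasurable μ _ h)
          simp only [Set.indicator_of_notMem hs]
          linarith
    calc ∫ s, U s ∂μ ≤ ∫ s, (ε / 4 + T.indicator (fun _ => M) s) ∂μ :=
          integral_mono_ae (integrable_of_abs_le hUm hUabs) ((integrable_const _).add hind) hle
      _ = ε / 4 + μ.real T * M := by
          rw [integral_add (integrable_const _) hind, integral_indicator_const _ hT]
          simp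
      _ ≤ ε / 4 + ε / (4 * M) * M := by gcongr
      _ = ε / 2 := by field_simp; ring
  have hn' : (0 : ℝ) < n := Nat.cast_pos.2 hn
  set l : ℝ := n * ε / (2 * M ^ 2) with hl
  have hl0 : 0 ≤ l := by positivity
  have hmgf := integral_exp_mul_le_of_ae_update_le P M (M / n) l n U hUm hUabs hUupd
  have hchernoff := ProbabilityTheory.measure_ge_le_exp_mul_mgf (μ := μ) (X := U) ε hl0
    (integrable_exp_mul_of_abs_le hUm hUabs l)
  calc μ {s | ε < g s} ≤ μ {s | ε ≤ U s} := measure_mono fun s hs => (le_of_lt hs).trans (hgU s)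
    _ = ENNReal.ofReal (μ.real {s | ε ≤ U s}) := (ofReal_measureReal).symm
    _ ≤ _ := ENNReal.ofReal_le_ofReal <| by
      calc μ.real {s | ε ≤ U s}
          ≤ Real.exp (-l * ε) * (Real.exp (l * ∫ s, U s ∂μ) *
              Real.exp (n * (l ^ 2 * (M / n) ^ 2 / 2))) :=
            hchernoff.trans (by gcongr; exact hmgf)
        _ ≤ Real.exp (-l * ε) * (Real.exp (l * (ε / 2)) *
              Real.exp (n * (l ^ 2 * (M / n) ^ 2 / 2))) := by gcongr
        _ = _ := by
            rw [← Real.exp_add, ← Real.exp_add, hl]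
            congr 1
            field_simp
            ring

/-! ### The empirical discrepancy of a class with finite oscillation -/

section EmpDev

variable {S : Type*} [MeasurableSpace S] {H : Set (S → ℝ)} {P : Measure S} {M : ℝ} {n : ℕ}

lemma abs_mean_sub_integral_le [IsProbabilityMeasure P] {f : S → ℝ} (hf : Integrable f P)
    (hosc : ∀ x y, |f x - f y| ≤ M) (hn : 0 < n) (s : Fin n → S) :
    |(∑ i, f (s i)) / n - ∫ x, f x ∂P| ≤ M := by
  have hn' : (0 : ℝ) < n := Nat.cast_pos.2 hn
  have hpt : ∀ x, |f x - ∫ y, f y ∂P| ≤ M := fun x => by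
    have heq : f x - ∫ y, f y ∂P = ∫ y, (f x - f y) ∂P := by
      rw [integral_sub (integrable_const _) hf]; simp
    rw [heq]
    simpa using norm_integral_le_of_norm_le_const (μ := P) (f := fun y => f x - f y)
      (ae_of_all _ fun y => hosc x y)
  have heq : (∑ i, f (s i)) / n - ∫ x, f x ∂P = (∑ i, (f (s i) - ∫ x, f x ∂P)) / n := by
    rw [Finset.sum_sub_distrib]
    simp
    field_simp
  rw [heq, abs_div, abs_of_pos hn', div_le_iff₀ hn']
  calc |∑ i, (f (s i) - ∫ x, f x ∂P)| ≤ ∑ i, |f (s i) - ∫ x, f x ∂P| :=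
        Finset.abs_sum_le_sum_abs _ _
    _ ≤ ∑ _i : Fin n, M := Finset.sum_le_sum fun i _ => hpt _
    _ = M * n := by simp [mul_comm]

lemma iSup_mem_le {ι : Type*} {s : Set ι} {φ : ι → ℝ} {B : ℝ} (hB : 0 ≤ B)
    (h : ∀ i ∈ s, φ i ≤ B) : ⨆ i ∈ s, φ i ≤ B :=
  Real.iSup_le (fun i => Real.iSup_le (fun hi => h i hi) hB) hB

lemma le_iSup_mem {ι : Type*} {s : Set ι} {φ : ι → ℝ}
    (h : BddAbove (Set.range fun i => ⨆ _ : i ∈ s, φ i)) {i : ι} (hi : i ∈ s) :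
    φ i ≤ ⨆ i ∈ s, φ i := by
  have := le_ciSup h i
  rwa [ciSup_pos hi] at this

lemma empDev_mem_Icc [IsProbabilityMeasure P] (hM : 0 ≤ M) (hf : ∀ f ∈ H, Integrable f P)
    (hosc : ∀ f ∈ H, ∀ x y, |f x - f y| ≤ M) (hn : 0 < n) (s : Fin n → S) :
    empDev H P n s ∈ Set.Icc 0 M :=
  ⟨Real.iSup_nonneg fun _ => Real.iSup_nonneg fun _ => abs_nonneg _,
    iSup_mem_le hM fun f hfH => abs_mean_sub_integral_le (hf f hfH) (hosc f hfH) hn s⟩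

lemma empDev_le_empDev_update [IsProbabilityMeasure P] (hM : 0 ≤ M)
    (hf : ∀ f ∈ H, Integrable f P) (hosc : ∀ f ∈ H, ∀ x y, |f x - f y| ≤ M) (hn : 0 < n)
    (i : Fin n) (z : S) (s : Fin n → S) :
    empDev H P n s ≤ empDev H P n (Function.update s i z) + M / n := by
  have hn' : (0 : ℝ) < n := Nat.cast_pos.2 hn
  have hnonneg := (empDev_mem_Icc hM hf hosc hn (Function.update s i z)).1
  refine iSup_mem_le (by positivity) fun f hfH => ?_
  have hbdd : BddAbove (Set.range fun f => ⨆ _ : f ∈ H,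
      |(∑ j, f (Function.update s i z j)) / n - ∫ x, f x ∂P|) :=
    ⟨M, Set.forall_mem_range.2 fun f => Real.iSup_le (fun h =>
      abs_mean_sub_integral_le (hf f h) (hosc f h) hn _) hM⟩
  have hle := le_iSup_mem hbdd hfH
  have hsum : ∑ j, f (s j) - ∑ j, f (Function.update s i z j) = f (s i) - f z := by
    rw [← Finset.sum_sub_distrib, Finset.sum_eq_single i]
    · simp
    · intro j _ hj
      simp [Function.update_of_ne hj]
    · simp
  have hdiff : |(∑ j, f (s j)) / n - (∑ j, f (Function.update s i z j)) / n| ≤ M / n := by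
    rw [← sub_div, hsum, abs_div, abs_of_pos hn']
    gcongr
    exact hosc f hfH _ _
  have htri := abs_sub_le ((∑ j, f (s j)) / n) ((∑ j, f (Function.update s i z j)) / n)
    (∫ x, f x ∂P)
  exact htri.trans ((add_le_add hdiff hle).trans_eq (add_comm _ _))

end EmpDev

lemma abs_sub_le_gcMReal {S : Type*} {H : Set (S → ℝ)}
    (hbdd : ∀ f ∈ H, ∃ B, ∀ x, |f x| ≤ B) (hM : gcMReal H ≠ 0) :
    ∀ f ∈ H, ∀ x y, |f x - f y| ≤ gcMReal H := by
  intro f hf x y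
  have hfin : BddAbove (Set.range fun f => ⨆ _ : f ∈ H, ((⨆ x, f x) - ⨅ x, f x)) := by
    by_contra h
    exact hM (Real.iSup_of_not_bddAbove h)
  refine le_trans ?_ (le_iSup_mem hfin hf)
  obtain ⟨B, hB⟩ := hbdd f hf
  have ha : BddAbove (Set.range f) := ⟨B, Set.forall_mem_range.2 fun x => (abs_le.1 (hB x)).2⟩
  have hb : BddBelow (Set.range f) := ⟨-B, Set.forall_mem_range.2 fun x => (abs_le.1 (hB x)).1⟩
  exact abs_sub_le_iff.2 ⟨sub_le_sub (le_ciSup ha x) (ciInf_le hb y),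
    sub_le_sub (le_ciSup ha y) (ciInf_le hb x)⟩

/-- If `H` is a weak uniform Glivenko–Cantelli class with `M = sup_{f ∈ H} [sup f − inf f]`,
then for every `ε > 0` there is `n₀` such that for all `n > n₀` and all probability measures `P`,
`Pⁿ{ ‖P_n − P‖_H* > ε } ≤ 2 exp(−3nε² / (8M(15M + ε)))`. -/
theorem exp_tail_bound_of_weakUniformGC {S : Type*} [MeasurableSpace S]
    (H : Set (S → ℝ))
    (hH : ∃ f ∈ H, ∃ x y : S, f x ≠ f y)
    (hint : ∀ f ∈ H, ∀ P : MeasureTheory.Measure S, MeasureTheory.IsProbabilityMeasure P →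
      MeasureTheory.Integrable f P)
    (hweak : IsWeakUniformGC H) :
    ∀ ε : ℝ, 0 < ε → ∃ n₀ : ℕ, ∀ n > n₀,
      ∀ P : MeasureTheory.Measure S, MeasureTheory.IsProbabilityMeasure P →
        (MeasureTheory.Measure.pi fun _ : Fin n => P) {s | ε < empDev H P n s} ≤
          ENNReal.ofReal (2 * Real.exp (-(3 * n * ε ^ 2) /
            (8 * gcMReal H * (15 * gcMReal H + ε)))) := by
  intro ε hε
  have hbdd : ∀ f ∈ H, ∃ B, ∀ x, |f x| ≤ B := fun f hf =>
    exists_abs_le_of_forall_integrable (hint f hf)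
  rcases eq_or_ne (gcMReal H) 0 with hM0 | hM0
  · refine ⟨0, fun n _ P hP => prob_le_one.trans ?_⟩
    simp [hM0]
  · have hosc := abs_sub_le_gcMReal hbdd hM0
    set M := gcMReal H
    have hM : 0 < M := by
      obtain ⟨f, hf, x, y, -⟩ := hH
      exact lt_of_le_of_ne ((abs_nonneg _).trans (hosc f hf x y)) hM0.symm
    obtain ⟨n₀, hn₀⟩ := eventually_atTop.1 ((hweak (ε / 4) (by positivity)).eventually_lt_const
      (show 0 < ENNReal.ofReal (ε / (4 * M)) from ENNReal.ofReal_pos.2 (by positivity)))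
    refine ⟨n₀, fun n hn P hP => ?_⟩
    have hn0 : 0 < n := by lia
    refine (pi_lt_le_of_update_le P hM hε hn0
      (empDev_mem_Icc hM.le (fun f hf => hint f hf P hP) hosc hn0)
      (empDev_le_empDev_update hM.le (fun f hf => hint f hf P hP) hosc hn0)
      ((le_iSup (fun Q : {P : Measure S // IsProbabilityMeasure P} =>
        (Measure.pi fun _ : Fin n => Q.1) {s | ε / 4 < empDev H Q.1 n s}) ⟨P, hP⟩).trans
          (hn₀ n hn.le).le)).trans (ENNReal.ofReal_le_ofReal ?_)
    have hexp : -(n * ε ^ 2) / (8 * M ^ 2) ≤ -(3 * n * ε ^ 2) / (8 * M * (15 * M + ε)) := by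
      rw [neg_div, neg_div, neg_le_neg_iff, div_le_div_iff₀ (by positivity) (by positivity)]
      have : 0 ≤ n * ε ^ 2 * (8 * M) * (12 * M + ε) := by positivity
      linarith
    linarith [Real.exp_le_exp.2 hexp, Real.exp_pos (-(3 * n * ε ^ 2) / (8 * M * (15 * M + ε)))]
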